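/- For every real number a and every τ in the complex upper half plane with y = Im τ, one has (1/2)|a| β(2ya²) e^{−πia²τ} − conj(e^{πia²τ})/(2π√(2y)) = (1/(4πi)) · conj( ∫_τ^{i∞} e^{πia²z} (−i(z − τ̄))^{−3/2} dz ), where the integral is taken along the vertical path from τ to i∞ and the power uses the principal branch (note −i(z−τ̄) has positive real part on this path). -/

import Mathlib

open Complex Real MeasureTheory

noncomputable section

/-- β(x) = ∫_x^∞ t^{−1/2} e^{−πt} dt. -/
def betaFun (x : ℝ) : ℝ := ∫ t in Set.Ioi x, Real.exp (-π * t) / Real.sqrt t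

end

open Set Filter Topology

/-- The antiderivative `-2 e^{-ku} / √u` used for integration by parts. -/
theorem hasDerivAt_neg_two_mul_exp_div_sqrt (k : ℝ) {u : ℝ} (hu : 0 < u) :
    HasDerivAt (fun u : ℝ => -2 * (Real.exp (-k * u) / √u))
      (Real.exp (-k * u) / (u * √u) + 2 * k * (Real.exp (-k * u) / √u)) u := by
  have hs : √u ≠ 0 := (Real.sqrt_pos.2 hu).ne'
  have h := ((((hasDerivAt_id u).const_mul (-k)).exp).div
    (Real.hasDerivAt_sqrt hu.ne') hs).const_mul (-2)
  refine h.congr_deriv ?_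
  have h2 : √u ^ 2 = u := Real.sq_sqrt hu.le
  simp only [id]
  rw [h2]
  field_simp
  rw [h2]
  ring

theorem tendsto_neg_two_mul_exp_div_sqrt {k : ℝ} (hk : 0 ≤ k) :
    Tendsto (fun u : ℝ => -2 * (Real.exp (-k * u) / √u)) atTop (𝓝 0) := by
  have h : Tendsto (fun u : ℝ => (√u)⁻¹) atTop (𝓝 0) :=
    tendsto_inv_atTop_zero.comp Real.tendsto_sqrt_atTop
  have h' : Tendsto (fun u : ℝ => Real.exp (-k * u) / √u) atTop (𝓝 0) := by
    refine tendsto_of_tendsto_of_tendsto_of_le_of_le' tendsto_const_nhds h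
      (Eventually.of_forall fun u => by positivity) ?_
    filter_upwards [eventually_ge_atTop 0] with u hu
    rw [div_eq_mul_inv]
    exact mul_le_of_le_one_left (by positivity)
      (Real.exp_le_one_iff.2 (by nlinarith [mul_nonneg hk hu]))
  simpa using h'.const_mul (-2)

/-- Integration by parts for the incomplete Gamma integral of exponent `-3/2`. -/
theorem integral_Ioi_exp_div_mul_sqrt {k c : ℝ} (hk : 0 ≤ k) (hc : 0 < c) :
    ∫ u in Ioi c, Real.exp (-k * u) / (u * √u)
      = 2 * (Real.exp (-k * c) / √c)
        - 2 * k * ∫ u in Ioi c, Real.exp (-k * u) / √u := by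
  have hderiv : ∀ u ∈ Ici c, HasDerivAt (fun u : ℝ => -2 * (Real.exp (-k * u) / √u))
      (Real.exp (-k * u) / (u * √u) + 2 * k * (Real.exp (-k * u) / √u)) u :=
    fun u hu => hasDerivAt_neg_two_mul_exp_div_sqrt k (hc.trans_le hu)
  have hnonneg : ∀ u ∈ Ioi c,
      0 ≤ Real.exp (-k * u) / (u * √u) + 2 * k * (Real.exp (-k * u) / √u) := fun u hu => by
    have : 0 < u := hc.trans hu
    positivity
  have hlim := tendsto_neg_two_mul_exp_div_sqrt hk
  have hint := integrableOn_Ioi_deriv_of_nonneg' hderiv hnonneg hlim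
  have hint₁ : IntegrableOn (fun u => Real.exp (-k * u) / (u * √u)) (Ioi c) := by
    refine Integrable.mono' hint (Measurable.aestronglyMeasurable (by fun_prop)) ?_
    filter_upwards [ae_restrict_mem measurableSet_Ioi] with u hu
    have : 0 < u := hc.trans hu
    rw [Real.norm_of_nonneg (by positivity)]
    exact le_add_of_nonneg_right (by positivity)
  have hint₂ : IntegrableOn (fun u => 2 * k * (Real.exp (-k * u) / √u)) (Ioi c) := by
    refine (hint.sub hint₁).congr (Eventually.of_forall fun u => ?_)
    simp
  have h := integral_Ioi_of_hasDerivAt_of_nonneg' hderiv hnonneg hlim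
  rw [integral_add hint₁ hint₂, integral_const_mul] at h
  linarith

theorem abs_mul_betaFun (a c : ℝ) :
    |a| * betaFun (c * a ^ 2)
      = a ^ 2 * ∫ u in Ioi c, Real.exp (-(π * a ^ 2) * u) / √u := by
  rcases eq_or_ne a 0 with rfl | ha
  · simp
  have ha' : 0 < |a| := abs_pos.2 ha
  have h := integral_comp_mul_left_Ioi (fun t => Real.exp (-π * t) / √t) c
    (show 0 < a ^ 2 by positivity)
  rw [betaFun, mul_comm c, ← sq_abs a]
  rw [← sq_abs a, smul_eq_mul] at h
  have h' : ∀ u, Real.exp (-π * (|a| ^ 2 * u)) / √(|a| ^ 2 * u)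
      = |a|⁻¹ * (Real.exp (-(π * |a| ^ 2) * u) / √u) := fun u => by
    rw [Real.sqrt_mul (by positivity), Real.sqrt_sq ha'.le]
    field_simp
  simp only [h', integral_const_mul] at h
  have hne := ha'.ne'
  generalize (∫ u in Ioi c, Real.exp (-(π * |a| ^ 2) * u) / √u) = J at h ⊢
  generalize (∫ t in Ioi (|a| ^ 2 * c), Real.exp (-π * t) / √t) = K at h ⊢
  field_simp at h
  rw [← h]
  ring

theorem integral_Ioi_zero_comp_add_right (f : ℝ → ℝ) (c : ℝ) :
    ∫ t in Ioi (0 : ℝ), f (t + c) = ∫ u in Ioi c, f u := by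
  have h := (measurePreserving_add_right volume c).setIntegral_preimage_emb
    (measurableEmbedding_addRight c) f (Ioi c)
  simpa using h

theorem integral_Ioi_zero_exp_mul_rpow (a : ℝ) {c : ℝ} (hc : 0 < c) :
    ∫ t in Ioi (0 : ℝ), Real.exp (-(π * a ^ 2) * t) * (t + c) ^ (-(3 : ℝ) / 2)
      = 2 / √c - 2 * π * Real.exp (π * a ^ 2 * c) * (|a| * betaFun (c * a ^ 2)) := by
  have hpow : ∀ t ∈ Ioi (0 : ℝ), Real.exp (-(π * a ^ 2) * t) * (t + c) ^ (-(3 : ℝ) / 2)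
      = Real.exp (π * a ^ 2 * c) *
        (Real.exp (-(π * a ^ 2) * (t + c)) / ((t + c) * √(t + c))) := fun t ht => by
    have hu : 0 < t + c := add_pos ht hc
    rw [show (-(3 : ℝ) / 2) = -(1 + 1 / 2) by norm_num, Real.rpow_neg hu.le,
      Real.rpow_add hu, Real.rpow_one, ← Real.sqrt_eq_rpow, ← mul_div_assoc, ← Real.exp_add,
      div_eq_mul_inv]
    congr 2
    ring
  rw [setIntegral_congr_fun measurableSet_Ioi hpow, integral_const_mul,
    integral_Ioi_zero_comp_add_right (fun u => Real.exp (-(π * a ^ 2) * u) / (u * √u)),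
    integral_Ioi_exp_div_mul_sqrt (by positivity) hc, abs_mul_betaFun, neg_mul, Real.exp_neg]
  field_simp

/-- termwise integral representation.  The integral from τ to i∞ along
the vertical path is parameterized by z = τ + t·i, t ∈ (0,∞), with dz = i dt, and the
power is the principal branch (cpow). -/
theorem termwise_integral_repr (a : ℝ) (τ : ℂ) (hτ : 0 < τ.im) :
    (1/2 : ℂ) * ((|a| * betaFun (2 * τ.im * a^2) : ℝ) : ℂ)
          * Complex.exp (-((π : ℂ) * I * (a : ℂ)^2 * τ))
        - (starRingEnd ℂ) (Complex.exp ((π : ℂ) * I * (a : ℂ)^2 * τ))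
          / (2 * (π : ℂ) * (Real.sqrt (2 * τ.im) : ℂ))
      = (1 / (4 * (π : ℂ) * I)) * (starRingEnd ℂ)
          (∫ t in Set.Ioi (0:ℝ), I * Complex.exp ((π : ℂ) * I * (a : ℂ)^2 * (τ + (t : ℂ) * I))
              * (-I * ((τ + (t : ℂ) * I) - (starRingEnd ℂ) τ)) ^ (-(3 : ℂ)/2)) := by
  have hintegrand : ∀ t ∈ Ioi (0 : ℝ),
      I * Complex.exp ((π : ℂ) * I * (a : ℂ)^2 * (τ + (t : ℂ) * I))
          * (-I * ((τ + (t : ℂ) * I) - (starRingEnd ℂ) τ)) ^ (-(3 : ℂ)/2)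
        = I * Complex.exp ((π : ℂ) * I * (a : ℂ)^2 * τ) *
          ((Real.exp (-(π * a ^ 2) * t) * (t + 2 * τ.im) ^ (-(3 : ℝ) / 2) : ℝ) : ℂ) := by
    intro t ht
    have hu : 0 ≤ t + 2 * τ.im := by linarith [mem_Ioi.1 ht]
    have hbase : -I * ((τ + (t : ℂ) * I) - (starRingEnd ℂ) τ) = ((t + 2 * τ.im : ℝ) : ℂ) := by
      rw [add_sub_right_comm, Complex.sub_conj]
      push_cast
      linear_combination (-(2 * (τ.im : ℂ) + t)) * I_sq
    have hexp : (π : ℂ) * I * (a : ℂ)^2 * (τ + (t : ℂ) * I)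
        = (π : ℂ) * I * (a : ℂ)^2 * τ + ((-(π * a ^ 2) * t : ℝ) : ℂ) := by
      push_cast
      linear_combination ((π : ℂ) * a ^ 2 * t) * I_sq
    rw [hbase, hexp, Complex.exp_add, Complex.ofReal_mul (Real.exp _),
      Complex.ofReal_exp, Complex.ofReal_cpow hu]
    push_cast
    ring
  have hconj : Complex.exp (-((π : ℂ) * I * (a : ℂ)^2 * τ))
      = (starRingEnd ℂ) (Complex.exp ((π : ℂ) * I * (a : ℂ)^2 * τ))
        * ((Real.exp (π * a ^ 2 * (2 * τ.im)) : ℝ) : ℂ) := by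
    rw [← Complex.exp_conj, Complex.ofReal_exp, ← Complex.exp_add]
    congr 1
    have h := Complex.sub_conj τ
    simp only [map_mul, map_pow, conj_I, conj_ofReal]
    push_cast at h ⊢
    linear_combination (-(π : ℂ) * I * a ^ 2) * h - (2 * (π : ℂ) * a ^ 2 * τ.im) * I_sq
  have hsqrt : ((√(2 * τ.im) : ℝ) : ℂ) ≠ 0 :=
    Complex.ofReal_ne_zero.2 (Real.sqrt_pos.2 (by positivity)).ne'
  have hpi : (π : ℂ) ≠ 0 := Complex.ofReal_ne_zero.2 Real.pi_ne_zero
  rw [setIntegral_congr_fun measurableSet_Ioi hintegrand, integral_const_mul,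
    integral_complex_ofReal, integral_Ioi_zero_exp_mul_rpow a (by positivity), hconj]
  simp only [map_mul, conj_I, conj_ofReal]
  push_cast
  field_simp
  ring
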